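/- arXiv:2211.07218 — 5 statements merged into one kernel-verified Lean document; each statement's English description precedes it below -/
import Mathlib

section
/- For every σ > 0, every q ∈ [0,1], and every natural number α, ∫ ((1 − q) + q·exp((2z − 1)/(2σ²)))^α dμ0(z) = Σ_{k=0}^{α} C(α,k) (1 − q)^{α−k} q^k exp((k² − k)/(2σ²)), where μ0 = N(0, σ²) and C(α,k) denotes the binomial coefficient. Equivalently, since the Radon–Nikodym derivative of the mixture μ_q = (1−q)·μ0 + q·μ1 with respect to μ0 equals (1−q) + q·exp((2z−1)/(2σ²)) a.e., the α-th moment ∫ (dμ_q/dμ0)^α dμ0 equals this binomial sum A_α(q,σ). -/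
open MeasureTheory ProbabilityTheory

/-- The Gaussian measure `N(m, σ²)` on `ℝ`. -/
noncomputable def gaussMeasure (m σ : ℝ) : Measure ℝ :=
  gaussianReal m ⟨σ ^ 2, sq_nonneg σ⟩

/-- For every `σ > 0`, `q ∈ [0,1]` and natural number `α`, the `α`-th moment of the
likelihood ratio `(1 - q) + q · exp ((2 z - 1) / (2 σ²))` of the sampled Gaussian mixture
`μ_q = (1 - q) μ₀ + q μ₁` against `μ₀ = N(0, σ²)` equals the binomial sum `A_α(q, σ)`:
`∫ ((1 - q) + q e^{(2z-1)/(2σ²)})^α dμ₀(z)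
  = ∑_{k=0}^{α} C(α,k) (1-q)^{α-k} q^k exp ((k² - k) / (2 σ²))`. -/
theorem integral_mixture_likelihood_pow_eq_binomial_sum (σ : ℝ) (hσ : 0 < σ)
    (q : ℝ) (hq0 : 0 ≤ q) (hq1 : q ≤ 1) (α : ℕ) :
    ∫ z, ((1 - q) + q * Real.exp ((2 * z - 1) / (2 * σ ^ 2))) ^ α ∂(gaussMeasure 0 σ)
      = ∑ k ∈ Finset.range (α + 1),
          (α.choose k : ℝ) * (1 - q) ^ (α - k) * q ^ k
            * Real.exp (((k : ℝ) ^ 2 - (k : ℝ)) / (2 * σ ^ 2)) := by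
  unfold gaussMeasure
  have hs : σ ≠ 0 := hσ.ne'
  have hint : ∀ t : ℝ, Integrable (fun z => Real.exp (t * z))
      (gaussianReal 0 ⟨σ ^ 2, sq_nonneg σ⟩) := fun t => integrable_exp_mul_gaussianReal t
  have hmgf : ∀ t : ℝ, ∫ z, Real.exp (t * z) ∂(gaussianReal 0 ⟨σ ^ 2, sq_nonneg σ⟩)
      = Real.exp (σ ^ 2 * t ^ 2 / 2) := by
    intro t
    have h := congrFun (mgf_id_gaussianReal (μ := 0) (v := ⟨σ ^ 2, sq_nonneg σ⟩)) t
    rw [zero_mul, zero_add] at h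
    exact h
  have hexp : ∀ z : ℝ, ((1 - q) + q * Real.exp ((2 * z - 1) / (2 * σ ^ 2))) ^ α
      = ∑ k ∈ Finset.range (α + 1), ((α.choose k : ℝ) * (1 - q) ^ (α - k) * q ^ k
          * Real.exp (-(k : ℝ) / (2 * σ ^ 2))) * Real.exp (((k : ℝ) / σ ^ 2) * z) := by
    intro z
    rw [add_comm, add_pow]
    refine Finset.sum_congr rfl fun k _ => ?_
    have h : Real.exp ((2 * z - 1) / (2 * σ ^ 2)) ^ k
        = Real.exp (-(k : ℝ) / (2 * σ ^ 2)) * Real.exp (((k : ℝ) / σ ^ 2) * z) := by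
      rw [← Real.exp_nat_mul, ← Real.exp_add]
      congr 1
      field_simp
      ring
    rw [mul_pow, h]
    ring
  simp_rw [hexp]
  rw [integral_finsetSum _ fun k _ => (hint _).const_mul _]
  refine Finset.sum_congr rfl fun k _ => ?_
  rw [integral_const_mul, hmgf, mul_assoc _ (Real.exp _), ← Real.exp_add]
  congr 2
  field_simp
  ring
end

section
/- For every q ∈ (0,1], every σ > 0, and every real α > 1, with μ0 = N(0, σ²), μ1 = N(1, σ²) and μ_q = (1−q)·μ0 + q·μ1 (mutually absolutely continuous measures on ℝ), the inequality B_α(q,σ) ≤ A_α(q,σ) holds, where A_α(q,σ) := ∫ (dμ_q/dμ0)^α dμ0 and B_α(q,σ) := ∫ (dμ0/dμ_q)^α dμ_q. In particular max(A_α(q,σ), B_α(q,σ)) = A_α(q,σ). -/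
open MeasureTheory ProbabilityTheory

/-- The sampled Gaussian mixture `μ_q = (1 - q) · N(0, σ²) + q · N(1, σ²)`. -/
noncomputable def sgMixture (σ q : ℝ) : Measure ℝ :=
  ENNReal.ofReal (1 - q) • gaussMeasure 0 σ + ENNReal.ofReal q • gaussMeasure 1 σ


lemma aux_tanh (c : ℝ) (hc : 1 ≤ c) (t : ℝ) (ht : 0 ≤ t) :
    Real.sinh (c*t) * Real.cosh t ≤ c * Real.sinh t * Real.cosh (c*t) := by
  have hd : ∀ t, HasDerivAt (fun t => c * Real.sinh t * Real.cosh (c*t) - Real.sinh (c*t) * Real.cosh t)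
      ((c^2-1) * (Real.sinh t * Real.sinh (c*t))) t := by
    intro t
    have h1 : HasDerivAt (fun t : ℝ => c * t) c t := by simpa using (hasDerivAt_id t).const_mul c
    have := ((((Real.hasDerivAt_sinh t).const_mul c).mul h1.cosh).sub (h1.sinh.mul (Real.hasDerivAt_cosh t)))
    refine this.congr_deriv ?_
    ring
  have hm : MonotoneOn (fun t => c * Real.sinh t * Real.cosh (c*t) - Real.sinh (c*t) * Real.cosh t) (Set.Ici 0) := by
    apply monotoneOn_of_deriv_nonneg (convex_Ici 0)
    · exact fun t _ => (hd t).continuousAt.continuousWithinAt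
    · exact fun t _ => (hd t).differentiableAt.differentiableWithinAt
    · intro t ht
      rw [(hd t).deriv]
      simp at ht
      have h1 := Real.sinh_nonneg_iff.2 ht.le
      have h2 : 0 ≤ Real.sinh (c*t) := Real.sinh_nonneg_iff.2 (by positivity)
      have : 0 ≤ c^2-1 := by nlinarith
      positivity
  have := hm (Set.mem_Ici.2 le_rfl) (Set.mem_Ici.2 ht) ht
  simp at this
  linarith

lemma aux_ratio (c : ℝ) (hc : 1 ≤ c) (x y : ℝ) (hy : 0 < y) (hxy : y ≤ x) :
    Real.sinh (c*y) * Real.sinh x ≤ Real.sinh (c*x) * Real.sinh y := by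
  have hd : ∀ t, 0 < t → HasDerivAt (fun t => Real.sinh (c*t) / Real.sinh t)
      ((Real.cosh (c*t) * c * Real.sinh t - Real.sinh (c*t) * Real.cosh t) / Real.sinh t ^2) t := by
    intro t ht
    have h1 : HasDerivAt (fun t : ℝ => c * t) c t := by simpa using (hasDerivAt_id t).const_mul c
    exact h1.sinh.div (Real.hasDerivAt_sinh t) (Real.sinh_pos_iff.2 ht).ne'
  have hm : MonotoneOn (fun t => Real.sinh (c*t) / Real.sinh t) (Set.Ioi 0) := by
    apply monotoneOn_of_deriv_nonneg (convex_Ioi 0)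
    · exact fun t ht => (hd t ht).continuousAt.continuousWithinAt
    · exact fun t ht => (hd t (by simpa using ht)).differentiableAt.differentiableWithinAt
    · intro t ht
      simp at ht
      rw [(hd t ht).deriv]
      have := aux_tanh c hc t ht.le
      apply div_nonneg _ (sq_nonneg _)
      linarith
  have := hm (Set.mem_Ioi.2 hy) (Set.mem_Ioi.2 (hy.trans_le hxy)) hxy
  simp only at this
  rwa [div_le_div_iff₀ (Real.sinh_pos_iff.2 hy) (Real.sinh_pos_iff.2 (hy.trans_le hxy))] at this

lemma aux_pow (a α : ℝ) (ha : 0 < a) :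
    a ^ α - a ^ (1-α) = 2 * Real.exp (Real.log a / 2) * Real.sinh ((2*α-1) * (Real.log a / 2)) := by
  rw [Real.sinh_eq, Real.rpow_def_of_pos ha, Real.rpow_def_of_pos ha]
  have : ∀ u v w : ℝ, 2 * u * ((v - w)/2) = u * v - u * w := by intros; ring
  rw [this, ← Real.exp_add, ← Real.exp_add]
  congr 2 <;> ring

lemma aux_pt1 (q α L : ℝ) (hq0 : 0 < q) (hq1 : q ≤ 1) (hα : 1 < α) (hL : 1 ≤ L) :
    0 ≤ ((1-q+q*L)^α - (1-q+q*L)^(1-α)) + L * ((1-q+q*L⁻¹)^α - (1-q+q*L⁻¹)^(1-α)) := by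
  rcases hL.eq_or_lt with rfl | hL
  · simp
  have hL0 : 0 < L := by linarith
  have hi : L⁻¹ < 1 := inv_lt_one_of_one_lt₀ hL
  have hi0 : 0 < L⁻¹ := inv_pos.2 hL0
  have hLi : L * L⁻¹ = 1 := mul_inv_cancel₀ hL0.ne'
  set M := L⁻¹ with hM
  set a := 1-q+q*L with ha
  set b := 1-q+q*M with hb
  have ha1 : 1 < a := by nlinarith
  have hb1 : b < 1 := by nlinarith
  have hb0 : 0 < b := by nlinarith [mul_pos hq0 hi0]
  have hab : 1 ≤ a * b := by
    have : a * b - 1 = q*(1-q)*(L+M-2) := by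
      rw [ha, hb]; linear_combination q^2*hLi
    have h2 : 0 ≤ L + M - 2 := by nlinarith [mul_nonneg hi0.le (sq_nonneg (L-1))]
    have := mul_nonneg (mul_nonneg hq0.le (sub_nonneg.2 hq1)) h2
    linarith
  have hlb : Real.log b < 0 := Real.log_neg hb0 hb1
  have hlog : 0 ≤ Real.log a + Real.log b := by
    rw [← Real.log_mul (by linarith) hb0.ne']; exact Real.log_nonneg hab
  have e1 := aux_pow a 1 (by linarith)
  have e2 := aux_pow b 1 hb0
  rw [aux_pow a α (by linarith), aux_pow b α hb0]
  have hc := aux_ratio (2*α-1) (by linarith) (Real.log a/2) (-(Real.log b/2)) (by linarith) (by linarith)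
  norm_num at e1 e2
  simp only [mul_neg, Real.sinh_neg] at hc
  have hS : 0 < Real.sinh (Real.log a/2) := Real.sinh_pos_iff.2 (by linarith [Real.log_pos ha1])
  set S := Real.sinh (Real.log a/2)
  set T := Real.sinh (Real.log b/2)
  set U := Real.exp (Real.log a/2)
  set V := Real.exp (Real.log b/2)
  set X := Real.sinh ((2*α-1)*(Real.log a/2))
  set Y := Real.sinh ((2*α-1)*(Real.log b/2))
  have hV : 0 < V := Real.exp_pos _
  have key : U * S + L * (V * T) = 0 := by
    have : (a - 1) + L * (b-1) = 0 := by rw [ha, hb]; linear_combination q*hLi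
    rw [e1, e2] at this; linarith
  -- S*(U X + L V Y) = -L V T X + L V S Y = L V (S Y - T X)
  have : 0 ≤ S * (2*U*X + L*(2*V*Y)) := by
    have h : S * (2*U*X + L*(2*V*Y)) = 2*(L*V)*(Y*S - X*T) := by linear_combination 2*X*key
    rw [h]
    have : 0 ≤ Y*S - X*T := by linarith
    positivity
  exact nonneg_of_mul_nonneg_right this hS

lemma aux_pt (q α L : ℝ) (hq0 : 0 < q) (hq1 : q ≤ 1) (hα : 1 < α) (hL : 0 < L) :
    0 ≤ ((1-q+q*L)^α - (1-q+q*L)^(1-α)) + L * ((1-q+q*L⁻¹)^α - (1-q+q*L⁻¹)^(1-α)) := by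
  rcases le_total 1 L with h | h
  · exact aux_pt1 q α L hq0 hq1 hα h
  · have := mul_nonneg hL.le (aux_pt1 q α L⁻¹ hq0 hq1 hα ((one_le_inv₀ hL).2 h))
    rw [mul_add, ← mul_assoc, mul_inv_cancel₀ hL.ne', inv_inv] at this
    linarith

noncomputable def auxV (σ : ℝ) : NNReal := ⟨σ ^ 2, sq_nonneg σ⟩
lemma auxV_coe (σ : ℝ) : (auxV σ : ℝ) = σ ^ 2 := rfl
lemma gaussMeasure_eq (m σ : ℝ) : gaussMeasure m σ = gaussianReal m (auxV σ) := rfl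

noncomputable def auxL (σ z : ℝ) : ℝ := Real.exp ((2*z-1)/(2*σ^2))
noncomputable def auxW (σ q z : ℝ) : ℝ := 1 - q + q * auxL σ z

lemma auxL_pos (σ z : ℝ) : 0 < auxL σ z := Real.exp_pos _

lemma auxW_pos (σ q z : ℝ) (hq0 : 0 < q) (hq1 : q ≤ 1) : 0 < auxW σ q z := by
  have := mul_pos hq0 (auxL_pos σ z)
  unfold auxW; linarith

lemma auxW_meas (σ q : ℝ) : Measurable (auxW σ q) := by
  unfold auxW auxL; fun_prop

lemma auxL_refl (σ z : ℝ) : auxL σ (1 - z) = (auxL σ z)⁻¹ := by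
  unfold auxL; rw [← Real.exp_neg]; congr 1; ring

lemma aux_pdf1 (σ z : ℝ) (hσ : 0 < σ) :
    gaussianPDFReal 1 (auxV σ) z = gaussianPDFReal 0 (auxV σ) z * auxL σ z := by
  unfold gaussianPDFReal auxL
  rw [mul_assoc _ (Real.exp _) (Real.exp _), ← Real.exp_add]
  congr 2
  rw [auxV_coe]
  field_simp
  ring

lemma aux_pdf_refl (σ z : ℝ) (hσ : 0 < σ) :
    gaussianPDFReal 0 (auxV σ) (1 - z) =
      gaussianPDFReal 0 (auxV σ) z * auxL σ z := by
  rw [← aux_pdf1 σ z hσ]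
  unfold gaussianPDFReal
  congr 3
  ring

lemma aux_var (σ : ℝ) (hσ : 0 < σ) : auxV σ ≠ 0 := by
  intro h
  have := congrArg NNReal.toReal h
  rw [auxV_coe] at this
  simp at this
  exact hσ.ne' this

lemma aux_mixture (σ q : ℝ) (hσ : 0 < σ) (hq0 : 0 < q) (hq1 : q ≤ 1) :
    sgMixture σ q = (gaussMeasure 0 σ).withDensity (fun z => ENNReal.ofReal (auxW σ q z)) := by
  unfold sgMixture
  rw [gaussMeasure_eq, gaussMeasure_eq]
  have hv := aux_var σ hσ
  rw [gaussianReal_of_var_ne_zero _ hv, gaussianReal_of_var_ne_zero _ hv,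
    ← withDensity_mul _ (measurable_gaussianPDF _ _) (auxW_meas σ q).ennreal_ofReal,
    ← withDensity_smul _ (measurable_gaussianPDF _ _), ← withDensity_smul _ (measurable_gaussianPDF _ _),
    ← withDensity_add_left ((measurable_gaussianPDF _ _).const_smul _)]
  congr 1
  ext z
  simp only [Pi.add_apply, Pi.smul_apply, Pi.mul_apply, smul_eq_mul, gaussianPDF]
  have h0 := gaussianPDFReal_nonneg 0 (auxV σ) z
  have h1 := gaussianPDFReal_nonneg 1 (auxV σ) z
  rw [← ENNReal.ofReal_mul (by linarith), ← ENNReal.ofReal_mul hq0.le, ← ENNReal.ofReal_mul h0,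
    ← ENNReal.ofReal_add (mul_nonneg (by linarith) h0) (mul_nonneg hq0.le h1), aux_pdf1 σ z hσ]
  congr 1
  unfold auxW
  ring

lemma aux_A (σ q α : ℝ) (hσ : 0 < σ) (hq0 : 0 < q) (hq1 : q ≤ 1) :
    (∫ z, ((sgMixture σ q).rnDeriv (gaussMeasure 0 σ) z).toReal ^ α ∂(gaussMeasure 0 σ)) =
    ∫ z, auxW σ q z ^ α ∂(gaussMeasure 0 σ) := by
  have : IsProbabilityMeasure (gaussMeasure 0 σ) := by rw [gaussMeasure_eq]; infer_instance
  rw [aux_mixture σ q hσ hq0 hq1]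
  apply integral_congr_ae
  filter_upwards [Measure.rnDeriv_withDensity (gaussMeasure 0 σ) (auxW_meas σ q).ennreal_ofReal] with z hz
  rw [hz, ENNReal.toReal_ofReal (auxW_pos σ q z hq0 hq1).le]

lemma aux_B (σ q α : ℝ) (hσ : 0 < σ) (hq0 : 0 < q) (hq1 : q ≤ 1) :
    (∫ z, ((gaussMeasure 0 σ).rnDeriv (sgMixture σ q) z).toReal ^ α ∂(sgMixture σ q)) =
    ∫ z, auxW σ q z ^ (1-α) ∂(gaussMeasure 0 σ) := by
  have : IsProbabilityMeasure (gaussMeasure 0 σ) := by rw [gaussMeasure_eq]; infer_instance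
  have hm := (auxW_meas σ q).ennreal_ofReal
  rw [aux_mixture σ q hσ hq0 hq1]
  have : SigmaFinite ((gaussMeasure 0 σ).withDensity (fun z => ENNReal.ofReal (auxW σ q z))) :=
    SigmaFinite.withDensity_of_ne_top (ae_of_all _ fun _ => ENNReal.ofReal_ne_top)
  rw [integral_withDensity_eq_integral_toReal_smul hm (ae_of_all _ fun _ => ENNReal.ofReal_lt_top)]
  apply integral_congr_ae
  have hac : gaussMeasure 0 σ ≪ (gaussMeasure 0 σ).withDensity (fun z => ENNReal.ofReal (auxW σ q z)) := by
    apply withDensity_absolutelyContinuous' hm.aemeasurable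
    exact ae_of_all _ fun z => by simpa using auxW_pos σ q z hq0 hq1
  filter_upwards [Measure.rnDeriv_withDensity (gaussMeasure 0 σ) hm, Measure.inv_rnDeriv' hac] with z hz hz2
  have hp := auxW_pos σ q z hq0 hq1
  rw [← hz2, Pi.inv_apply, hz, ENNReal.toReal_inv, ENNReal.toReal_ofReal hp.le, smul_eq_mul,
    Real.rpow_sub hp, Real.rpow_one, Real.inv_rpow hp.le, div_eq_mul_inv]

lemma aux_intA (σ q α : ℝ) (hq0 : 0 < q) (hq1 : q ≤ 1) (hα : 1 < α) :
    Integrable (fun z => auxW σ q z ^ α) (gaussMeasure 0 σ) := by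
  have : IsProbabilityMeasure (gaussMeasure 0 σ) := by rw [gaussMeasure_eq]; infer_instance
  have hL : Integrable (fun z => auxL σ z ^ α) (gaussMeasure 0 σ) := by
    have h := (integrable_exp_mul_gaussianReal (μ := 0) (v := (auxV σ))
      (2/(2*σ^2)*α)).const_mul (Real.exp (-1/(2*σ^2)*α))
    refine h.congr (ae_of_all _ fun z => ?_)
    simp only [auxL]
    rw [← Real.exp_mul, ← Real.exp_add]
    congr 1
    ring
  refine ((integrable_const (1-q)).add (hL.const_mul q)).mono'
    ((auxW_meas σ q).pow_const α).aestronglyMeasurable (ae_of_all _ fun z => ?_)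
  rw [Real.norm_of_nonneg (Real.rpow_nonneg (auxW_pos σ q z hq0 hq1).le _)]
  have := (convexOn_rpow hα.le).2 (Set.mem_Ici.2 zero_le_one) (Set.mem_Ici.2 (auxL_pos σ z).le)
    (sub_nonneg.2 hq1) hq0.le (by ring)
  simpa [auxW] using this

lemma aux_main (σ q α : ℝ) (hσ : 0 < σ) (hq0 : 0 < q) (hq1 : q ≤ 1) (hα : 1 < α) :
    ∫ z, auxW σ q z ^ (1-α) ∂(gaussMeasure 0 σ) ≤ ∫ z, auxW σ q z ^ α ∂(gaussMeasure 0 σ) := by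
  by_cases hB : Integrable (fun z => auxW σ q z ^ (1-α)) (gaussMeasure 0 σ)
  swap
  · rw [integral_undef hB]
    exact integral_nonneg fun z => Real.rpow_nonneg (auxW_pos σ q z hq0 hq1).le _
  have hA := aux_intA σ q α hq0 hq1 hα
  have hD := hA.sub hB
  rw [← sub_nonneg, ← integral_sub hA hB]
  have hv := aux_var σ hσ
  rw [gaussMeasure_eq] at hD ⊢
  rw [integral_gaussianReal_eq_integral_smul hv]
  rw [gaussianReal_of_var_ne_zero _ hv, integrable_withDensity_iff_integrable_smul'
    (measurable_gaussianPDF _ _) (ae_of_all _ fun _ => gaussianPDF_lt_top)] at hD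
  simp only [toReal_gaussianPDF, smul_eq_mul, Pi.sub_apply] at hD ⊢
  set F := fun z => gaussianPDFReal 0 (auxV σ) z * (auxW σ q z ^ α - auxW σ q z ^ (1-α)) with hF
  have e := integral_sub_left_eq_self F volume 1
  have hs : 0 ≤ ∫ z, (F z + F (1 - z)) := by
    refine integral_nonneg fun z => ?_
    have := mul_nonneg (gaussianPDFReal_nonneg 0 (auxV σ) z)
      (aux_pt q α (auxL σ z) hq0 hq1 hα (auxL_pos σ z))
    simp only [hF, aux_pdf_refl σ z hσ, auxW, auxL_refl, Pi.zero_apply]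
    linarith
  rw [integral_add hD (hD.comp_sub_left 1), e] at hs
  linarith

/-- For every `q ∈ (0,1]`, `σ > 0` and real `α > 1`, the reverse moment of the likelihood
ratio is bounded by the forward one: `B_α(q,σ) ≤ A_α(q,σ)`, where
`A_α(q,σ) = ∫ (dμ_q/dμ₀)^α dμ₀` and `B_α(q,σ) = ∫ (dμ₀/dμ_q)^α dμ_q`.
In particular `max (A_α(q,σ)) (B_α(q,σ)) = A_α(q,σ)`. -/
theorem reverse_moment_le_forward_moment (σ : ℝ) (hσ : 0 < σ)
    (q : ℝ) (hq0 : 0 < q) (hq1 : q ≤ 1) (α : ℝ) (hα : 1 < α) :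
    (∫ z, ((gaussMeasure 0 σ).rnDeriv (sgMixture σ q) z).toReal ^ α ∂(sgMixture σ q))
      ≤ (∫ z, ((sgMixture σ q).rnDeriv (gaussMeasure 0 σ) z).toReal ^ α ∂(gaussMeasure 0 σ)) ∧
    max (∫ z, ((sgMixture σ q).rnDeriv (gaussMeasure 0 σ) z).toReal ^ α ∂(gaussMeasure 0 σ))
        (∫ z, ((gaussMeasure 0 σ).rnDeriv (sgMixture σ q) z).toReal ^ α ∂(sgMixture σ q))
      = ∫ z, ((sgMixture σ q).rnDeriv (gaussMeasure 0 σ) z).toReal ^ α ∂(gaussMeasure 0 σ) := by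
  rw [aux_A σ q α hσ hq0 hq1, aux_B σ q α hσ hq0 hq1]
  have h := aux_main σ q α hσ hq0 hq1 hα
  exact ⟨h, max_eq_left h⟩
end

section
/- For every σ > 0, every q ∈ (0,1], and every natural number α ≥ 2, the Rényi divergence of order α from μ0 to the sampled Gaussian mixture μ_q satisfies D_α(μ0 ‖ μ_q) ≤ (1/(α−1)) · log( Σ_{k=0}^{α} C(α,k) (1 − q)^{α−k} q^k exp((k² − k)/(2σ²)) ), where D_α(μ ‖ ν) := (1/(α−1)) log ∫ (dμ/dν)^α dν. -/
open MeasureTheory ProbabilityTheory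

/-- The Rényi divergence of order `α` between two measures,
`D_α(μ ‖ ν) = (1/(α-1)) log ∫ (dμ/dν)^α dν`. -/
noncomputable def renyiDiv {X : Type*} [MeasurableSpace X] (α : ℝ) (μ ν : Measure X) : ℝ :=
  (1 / (α - 1)) * Real.log (∫ x, (μ.rnDeriv ν x).toReal ^ α ∂ν)

lemma alg (q r s t : ℝ) (hq0 : 0 < q) (hq1 : q ≤ 1) (hr : 0 < r) (hs : s = 1 - q + q * r)
   (ht : t = 1 - q + q * r⁻¹) (n : ℕ) :
   0 ≤ (s^(n+1) - s * (s⁻¹)^(n+1)) + r * (t^(n+1) - t * (t⁻¹)^(n+1)) := by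
  have hri : 0 < r⁻¹ := by positivity
  have hrr : r * r⁻¹ = 1 := mul_inv_cancel₀ hr.ne'
  have hs0 : 0 < s := by have := mul_pos hq0 hr; linarith
  have ht0 : 0 < t := by have := mul_pos hq0 hri; linarith
  have hst : 1 ≤ s * t := by
    have h2 : 2 ≤ r + r⁻¹ := by
      have : r + r⁻¹ - 2 = r⁻¹ * (r - 1)^2 := by
        field_simp
        ring
      have h3 : 0 ≤ r⁻¹ * (r - 1)^2 := by positivity
      linarith
    have : s * t = (1-q)^2 + q^2 * (r * r⁻¹) + q * (1-q) * (r + r⁻¹) := by rw [hs, ht]; ring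
    rw [this, hrr]
    nlinarith [mul_nonneg hq0.le (sub_nonneg.2 hq1)]
  have hrt : r * (t - 1) = -(s-1) := by
    rw [hs, ht]; linear_combination q * hrr
  induction n with
  | zero => 
    have h1 : s * s⁻¹ = 1 := mul_inv_cancel₀ hs0.ne'
    have h2 : t * t⁻¹ = 1 := mul_inv_cancel₀ ht0.ne'
    simp only [zero_add, pow_one, h1, h2]; linarith
  | succ n ih =>
    have key : 0 ≤ (s-1) * (s^(n+1) + (s⁻¹)^(n+1+1) * s - t^(n+1) - (t⁻¹)^(n+1+1) * t) := by
      have e : s^(n+1) + (s⁻¹)^(n+1+1) * s - t^(n+1) - (t⁻¹)^(n+1+1) * t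
        = (s^(n+1) - t^(n+1)) * (1 - ((s*t)^(n+1))⁻¹) := by
        simp only [inv_pow, mul_pow]
        field_simp
        ring
      rw [e]
      have h3 : 0 ≤ 1 - ((s*t)^(n+1))⁻¹ := by
        have := inv_le_one_of_one_le₀ (one_le_pow₀ hst (n := n+1)); linarith
      rcases le_total 1 r with h | h
      · have : r⁻¹ ≤ 1 := inv_le_one_of_one_le₀ h
        have a : 1 ≤ s := by nlinarith
        have b : t ≤ s := by nlinarith
        have c := pow_le_pow_left₀ ht0.le b (n+1)
        exact mul_nonneg (by linarith) (mul_nonneg (by linarith) h3)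
      · have : 1 ≤ r⁻¹ := (one_le_inv₀ hr).2 h
        have a : s ≤ 1 := by nlinarith
        have b : s ≤ t := by nlinarith
        have c := pow_le_pow_left₀ hs0.le b (n+1)
        exact mul_nonneg_of_nonpos_of_nonpos (by linarith) (mul_nonpos_of_nonpos_of_nonneg (by linarith) h3)
    have h1 : s * s⁻¹ = 1 := mul_inv_cancel₀ hs0.ne'
    have h2 : t * t⁻¹ = 1 := mul_inv_cancel₀ ht0.ne'
    have es : s * (s⁻¹)^(n+1) = s * ((s⁻¹)^(n+1+1) * s) := by
      rw [pow_succ _ (n+1)]; linear_combination (-s * (s⁻¹)^(n+1)) * h1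
    have et : t * (t⁻¹)^(n+1) = t * ((t⁻¹)^(n+1+1) * t) := by
      rw [pow_succ _ (n+1)]; linear_combination (-t * (t⁻¹)^(n+1)) * h2
    have : (s^(n+1+1) - s * (s⁻¹)^(n+1+1)) + r * (t^(n+1+1) - t * (t⁻¹)^(n+1+1)) =
       ((s^(n+1) - s * (s⁻¹)^(n+1)) + r * (t^(n+1) - t * (t⁻¹)^(n+1))) + (s-1) * (s^(n+1) + (s⁻¹)^(n+1+1) * s - t^(n+1) - (t⁻¹)^(n+1+1) * t) := by
      rw [es, et]
      linear_combination (t^(n+1) + (t⁻¹)^(n+1+1) * t) * hrt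
    linarith

noncomputable def sgR (σ x : ℝ) : ℝ := Real.exp (σ⁻¹ ^ 2 * x - σ⁻¹ ^ 2 / 2)
noncomputable def sgS (σ q x : ℝ) : ℝ := 1 - q + q * sgR σ x

lemma sgR_pos (σ x : ℝ) : 0 < sgR σ x := Real.exp_pos _

lemma sgS_pos {σ q x : ℝ} (hq0 : 0 < q) (hq1 : q ≤ 1) : 0 < sgS σ q x := by
  have := mul_pos hq0 (sgR_pos σ x)
  unfold sgS; linarith

lemma sgR_cont (σ : ℝ) : Continuous (sgR σ) := by unfold sgR; fun_prop
lemma sgS_cont (σ q : ℝ) : Continuous (sgS σ q) := by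
  have := sgR_cont σ
  unfold sgS; fun_prop

lemma sgR_reflect (σ x : ℝ) : sgR σ (1 - x) = (sgR σ x)⁻¹ := by
  unfold sgR; rw [← Real.exp_neg]; congr 1; ring

noncomputable def sgV (σ : ℝ) : NNReal := ⟨σ ^ 2, sq_nonneg σ⟩

lemma sgV_coe (σ : ℝ) : ((sgV σ : NNReal) : ℝ) = σ ^ 2 := rfl

lemma gm_eq (m σ : ℝ) : gaussMeasure m σ = gaussianReal m (sgV σ) := rfl

instance gm_prob (m σ : ℝ) : IsProbabilityMeasure (gaussMeasure m σ) := by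
  rw [gm_eq]; infer_instance

lemma var_ne {σ : ℝ} (hσ : 0 < σ) : sgV σ ≠ 0 := by
  intro h
  have h2 : σ ^ 2 = 0 := congrArg NNReal.toReal h
  exact (pow_pos hσ 2).ne' h2

lemma pdf_one {σ : ℝ} (hσ : 0 < σ) (x : ℝ) :
    gaussianPDFReal 1 (sgV σ) x =
      gaussianPDFReal 0 (sgV σ) x * sgR σ x := by
  unfold gaussianPDFReal sgR
  rw [mul_assoc _ (Real.exp _) (Real.exp _), ← Real.exp_add]
  congr 2
  rw [sgV_coe]
  field_simp
  ring

lemma pdf_reflect {σ : ℝ} (hσ : 0 < σ) (x : ℝ) :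
    gaussianPDFReal 0 (sgV σ) (1 - x) =
      gaussianPDFReal 0 (sgV σ) x * sgR σ x := by
  rw [← pdf_one hσ]
  unfold gaussianPDFReal
  congr 3
  ring

lemma gauss_one {σ : ℝ} (hσ : 0 < σ) :
    gaussMeasure 1 σ = (gaussMeasure 0 σ).withDensity (fun x => ENNReal.ofReal (sgR σ x)) := by
  rw [gm_eq, gm_eq]
  rw [gaussianReal_of_var_ne_zero _ (var_ne hσ), gaussianReal_of_var_ne_zero _ (var_ne hσ),
    ← withDensity_mul _ (measurable_gaussianPDF _ _) (sgR_cont σ).measurable.ennreal_ofReal]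
  congr 1
  ext x
  simp only [gaussianPDF, Pi.mul_apply]
  rw [pdf_one hσ, ENNReal.ofReal_mul (gaussianPDFReal_nonneg _ _ _)]

lemma mixture_eq {σ q : ℝ} (hσ : 0 < σ) (hq0 : 0 < q) (hq1 : q ≤ 1) :
    sgMixture σ q = (gaussMeasure 0 σ).withDensity (fun x => ENNReal.ofReal (sgS σ q x)) := by
  have hm : Measurable (fun x => ENNReal.ofReal (sgR σ x)) :=
    (sgR_cont σ).measurable.ennreal_ofReal
  have : (fun x => ENNReal.ofReal (sgS σ q x)) =
      (fun _ => ENNReal.ofReal (1 - q)) +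
        ENNReal.ofReal q • (fun x => ENNReal.ofReal (sgR σ x)) := by
    ext x
    simp only [Pi.add_apply, Pi.smul_apply, smul_eq_mul]
    rw [← ENNReal.ofReal_mul hq0.le, ← ENNReal.ofReal_add (by linarith)
      (mul_nonneg hq0.le (sgR_pos _ _).le)]
    rfl
  rw [this, withDensity_add_left measurable_const, withDensity_const, withDensity_smul _ hm,
    ← gauss_one hσ]
  rfl

lemma renyi_integral {σ q : ℝ} (hσ : 0 < σ) (hq0 : 0 < q) (hq1 : q ≤ 1) (α : ℕ) :
    ∫ x, ((gaussMeasure 0 σ).rnDeriv (sgMixture σ q) x).toReal ^ (α : ℝ) ∂(sgMixture σ q) =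
      ∫ x, sgS σ q x * (sgS σ q x)⁻¹ ^ α ∂(gaussMeasure 0 σ) := by
  have hm : Measurable (fun x => ENNReal.ofReal (sgS σ q x)) :=
    (sgS_cont σ q).measurable.ennreal_ofReal
  have hf : IsFiniteMeasure (sgMixture σ q) := by
    unfold sgMixture
    have a : IsFiniteMeasure (ENNReal.ofReal (1 - q) •
      gaussMeasure 0 σ) := Measure.smul_finite _ ENNReal.ofReal_ne_top
    have b : IsFiniteMeasure (ENNReal.ofReal q •
      gaussMeasure 1 σ) := Measure.smul_finite _ ENNReal.ofReal_ne_top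
    infer_instance
  have h1 : (sgMixture σ q).withDensity (fun x => (ENNReal.ofReal (sgS σ q x))⁻¹)
      = gaussMeasure 0 σ := by
    rw [mixture_eq hσ hq0 hq1]
    exact withDensity_inv_same hm (ae_of_all _ fun x => by simpa using sgS_pos hq0 hq1)
      (ae_of_all _ fun x => ENNReal.ofReal_ne_top)
  have h2 := Measure.rnDeriv_withDensity (sgMixture σ q) hm.inv
  have h3 : (fun x => ENNReal.ofReal (sgS σ q x))⁻¹ =
    (fun x => (ENNReal.ofReal (sgS σ q x))⁻¹) := rfl
  rw [h3, h1] at h2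
  have h4 : ∫ x, ((gaussMeasure 0 σ).rnDeriv (sgMixture σ q) x).toReal ^ (α : ℝ) ∂(sgMixture σ q)
      = ∫ x, (sgS σ q x)⁻¹ ^ α ∂(sgMixture σ q) := by
    apply integral_congr_ae
    filter_upwards [h2] with x hx
    rw [hx, Real.rpow_natCast, ENNReal.toReal_inv, ENNReal.toReal_ofReal (sgS_pos hq0 hq1).le]
  rw [h4, mixture_eq hσ hq0 hq1, integral_withDensity_eq_integral_toReal_smul hm
    (ae_of_all _ fun x => ENNReal.ofReal_lt_top)]
  refine integral_congr_ae (ae_of_all _ fun x => ?_)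
  simp only [smul_eq_mul]
  rw [ENNReal.toReal_ofReal (sgS_pos hq0 hq1).le]

lemma int_exp (σ a b : ℝ) :
    Integrable (fun x => Real.exp (a * x + b)) (gaussMeasure 0 σ) := by
  simp_rw [Real.exp_add]
  exact (integrable_exp_mul_gaussianReal a).mul_const _

lemma sgR_pow (σ x : ℝ) (k : ℕ) :
    sgR σ x ^ k = Real.exp ((k * σ⁻¹ ^ 2) * x + -(k * σ⁻¹ ^ 2 / 2)) := by
  unfold sgR; rw [← Real.exp_nat_mul]; congr 1; ring

lemma int_sgR_pow (σ : ℝ) (k : ℕ) : Integrable (fun x => sgR σ x ^ k) (gaussMeasure 0 σ) := by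
  simp_rw [sgR_pow]; exact int_exp _ _ _

lemma integral_sgR_pow {σ : ℝ} (hσ : 0 < σ) (k : ℕ) :
    ∫ x, sgR σ x ^ k ∂(gaussMeasure 0 σ) =
      Real.exp (((k : ℝ) ^ 2 - (k : ℝ)) / (2 * σ ^ 2)) := by
  simp_rw [sgR_pow, Real.exp_add]
  rw [integral_mul_const]
  rw [gm_eq]
  have h : mgf id (gaussianReal 0 (sgV σ)) (k * σ⁻¹ ^ 2) = _ :=
    congrFun mgf_id_gaussianReal (k * σ⁻¹ ^ 2)
  simp only [mgf, id] at h
  rw [h, ← Real.exp_add]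
  congr 1
  rw [sgV_coe]
  field_simp
  ring

lemma sgS_pow (σ q x : ℝ) (α : ℕ) : sgS σ q x ^ α = ∑ k ∈ Finset.range (α + 1),
    ((α.choose k : ℝ) * (1 - q) ^ (α - k) * q ^ k) * sgR σ x ^ k := by
  unfold sgS
  rw [add_comm, add_pow]
  refine Finset.sum_congr rfl fun k _ => ?_
  rw [mul_pow]; ring

lemma int_sgS_pow (σ q : ℝ) (α : ℕ) : Integrable (fun x => sgS σ q x ^ α) (gaussMeasure 0 σ) := by
  simp_rw [sgS_pow]
  exact integrable_finsetSum _ fun k _ => (int_sgR_pow σ k).const_mul _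

lemma integral_sgS_pow {σ : ℝ} (hσ : 0 < σ) (q : ℝ) (α : ℕ) :
    ∫ x, sgS σ q x ^ α ∂(gaussMeasure 0 σ) = ∑ k ∈ Finset.range (α + 1),
          (α.choose k : ℝ) * (1 - q) ^ (α - k) * q ^ k
            * Real.exp (((k : ℝ) ^ 2 - (k : ℝ)) / (2 * σ ^ 2)) := by
  simp_rw [sgS_pow]
  rw [integral_finsetSum _ fun k _ => (int_sgR_pow σ k).const_mul _]
  refine Finset.sum_congr rfl fun k _ => ?_
  rw [integral_const_mul, integral_sgR_pow hσ]

lemma int_inv {σ q : ℝ} (hq0 : 0 < q) (hq1 : q ≤ 1) (n : ℕ) :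
    Integrable (fun x => sgS σ q x * (sgS σ q x)⁻¹ ^ (n + 1)) (gaussMeasure 0 σ) := by
  have e : ∀ x, sgS σ q x * (sgS σ q x)⁻¹ ^ (n + 1) = (sgS σ q x)⁻¹ ^ n := fun x => by
    have := mul_inv_cancel₀ (sgS_pos (σ := σ) (x := x) hq0 hq1).ne'
    rw [pow_succ]; linear_combination (sgS σ q x)⁻¹ ^ n * this
  simp_rw [e]
  have hi : Integrable (fun x => q⁻¹ ^ n * Real.exp (-(n * σ⁻¹ ^ 2) * x + (n * σ⁻¹ ^ 2 / 2)))
    (gaussMeasure 0 σ) := (int_exp σ _ _).const_mul _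
  refine hi.mono' ?_ (ae_of_all _ fun x => ?_)
  · exact (((sgS_cont σ q).measurable.inv).pow_const n).aestronglyMeasurable
  · have hs := sgS_pos (σ := σ) (x := x) hq0 hq1
    rw [Real.norm_of_nonneg (by positivity)]
    have hr := sgR_pos σ x
    have : q * sgR σ x ≤ sgS σ q x := by unfold sgS; linarith
    calc (sgS σ q x)⁻¹ ^ n ≤ (q * sgR σ x)⁻¹ ^ n := by gcongr
      _ = q⁻¹ ^ n * (sgR σ x ^ n)⁻¹ := by rw [mul_inv, mul_pow, inv_pow (sgR σ x)]
      _ = _ := by rw [sgR_pow, ← Real.exp_neg]; congr 2; ring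

lemma main_ineq {σ q : ℝ} (hσ : 0 < σ) (hq0 : 0 < q) (hq1 : q ≤ 1) (n : ℕ) :
    ∫ x, sgS σ q x * (sgS σ q x)⁻¹ ^ (n + 1) ∂(gaussMeasure 0 σ)
      ≤ ∫ x, sgS σ q x ^ (n + 1) ∂(gaussMeasure 0 σ) := by
  have hA := int_sgS_pow σ q (n + 1)
  have hB := int_inv (σ := σ) hq0 hq1 n
  rw [← sub_nonneg, ← integral_sub hA hB]
  have hI := hA.sub hB
  set F : ℝ → ℝ := fun x => sgS σ q x ^ (n + 1) - sgS σ q x * (sgS σ q x)⁻¹ ^ (n + 1) with hF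
  set p : ℝ → ℝ := gaussianPDFReal 0 (sgV σ) with hp
  have hI' : Integrable F (gaussMeasure 0 σ) := hI
  have e : ∫ x, F x ∂(gaussMeasure 0 σ) = ∫ x, p x * F x :=
    integral_gaussianReal_eq_integral_smul (var_ne hσ)
  have hG : Integrable (fun x => p x * F x) := by
    rw [gm_eq] at hI'
    rw [gaussianReal_of_var_ne_zero _ (var_ne hσ), integrable_withDensity_iff_integrable_smul'
      (measurable_gaussianPDF _ _) (ae_of_all _ fun _ => gaussianPDF_lt_top)] at hI'
    simpa [hp] using hI'
  have hG' : Integrable (fun x => p (1 - x) * F (1 - x)) := hG.comp_sub_left 1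
  have e2 : ∫ x, p (1 - x) * F (1 - x) = ∫ x, p x * F x :=
    integral_sub_left_eq_self (fun x => p x * F x) volume 1
  have h0 : 0 ≤ ∫ x, (p x * F x + p (1 - x) * F (1 - x)) := by
    apply integral_nonneg
    intro x
    have h1 := alg q (sgR σ x) (sgS σ q x) (sgS σ q (1 - x)) hq0 hq1 (sgR_pos _ _) rfl
      (by unfold sgS; rw [sgR_reflect]) n
    have h2 : p (1 - x) = p x * sgR σ x := pdf_reflect hσ x
    have h3 : 0 ≤ p x := gaussianPDFReal_nonneg _ _ _
    have h4 := mul_nonneg h3 h1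
    simp only [Pi.zero_apply]
    rw [h2]
    simp only [hF]
    linarith
  rw [integral_add hG hG', e2] at h0
  change 0 ≤ ∫ x, F x ∂(gaussMeasure 0 σ)
  rw [e]; linarith

/-- For every `σ > 0`, `q ∈ (0,1]` and natural number `α ≥ 2`, the Rényi divergence of
order `α` from `μ₀ = N(0, σ²)` to the sampled Gaussian mixture `μ_q` is at most
`(1/(α-1)) log (∑_{k=0}^{α} C(α,k) (1-q)^{α-k} q^k exp ((k²-k)/(2σ²)))`. -/
theorem renyiDiv_reverse_sgMixture_le (σ : ℝ) (hσ : 0 < σ)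
    (q : ℝ) (hq0 : 0 < q) (hq1 : q ≤ 1) (α : ℕ) (hα : 2 ≤ α) :
    renyiDiv (α : ℝ) (gaussMeasure 0 σ) (sgMixture σ q)
      ≤ (1 / ((α : ℝ) - 1)) * Real.log (∑ k ∈ Finset.range (α + 1),
          (α.choose k : ℝ) * (1 - q) ^ (α - k) * q ^ k
            * Real.exp (((k : ℝ) ^ 2 - (k : ℝ)) / (2 * σ ^ 2))) := by
  unfold renyiDiv
  rw [renyi_integral hσ hq0 hq1, ← integral_sgS_pow hσ]
  obtain ⟨n, rfl⟩ : ∃ n, α = n + 1 := ⟨α - 1, by omega⟩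
  have h1 : (2 : ℝ) ≤ ((n + 1 : ℕ) : ℝ) := by exact_mod_cast hα
  refine mul_le_mul_of_nonneg_left (Real.log_le_log ?_ (main_ineq hσ hq0 hq1 n))
    (by apply one_div_nonneg.2; linarith)
  have hpos : ∀ x, 0 < sgS σ q x * (sgS σ q x)⁻¹ ^ (n + 1) := fun x => by
    have := sgS_pos (σ := σ) (x := x) hq0 hq1
    positivity
  rw [integral_pos_iff_support_of_nonneg (fun x => (hpos x).le) (int_inv hq0 hq1 n)]
  have : Function.support (fun x => sgS σ q x * (sgS σ q x)⁻¹ ^ (n + 1)) = Set.univ := by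
    ext x; simpa using (hpos x).ne'
  rw [this]
  simp
end

section
/- For every σ > 0, every q ∈ (0,1], every natural number α ≥ 2, and every natural number T ≥ 1, the T-fold product measures satisfy ∫ (d(μ_q^{⊗T})/d(μ0^{⊗T}))^α d(μ0^{⊗T}) = ( Σ_{k=0}^{α} C(α,k) (1 − q)^{α−k} q^k exp((k² − k)/(2σ²)) )^T, and hence D_α(μ_q^{⊗T} ‖ μ0^{⊗T}) = (T/(α−1)) · log( Σ_{k=0}^{α} C(α,k) (1 − q)^{α−k} q^k exp((k² − k)/(2σ²)) ). -/
open MeasureTheory ProbabilityTheory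

theorem aux_pi_withDensity {T : ℕ} (μ : Measure ℝ) [IsProbabilityMeasure μ]
    (f : ℝ → ENNReal) (hf : Measurable f) [IsProbabilityMeasure (μ.withDensity f)] :
    (Measure.pi fun _ : Fin T => μ.withDensity f)
      = (Measure.pi fun _ : Fin T => μ).withDensity (fun x => ∏ i, f (x i)) := by
  refine Measure.pi_eq (fun s hs => ?_)
  rw [withDensity_apply _ (MeasurableSet.univ_pi hs), ← lintegral_indicator (MeasurableSet.univ_pi hs)]
  have h1 : ∀ x : Fin T → ℝ, (Set.univ.pi s).indicator (fun x => ∏ i, f (x i)) x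
      = ∏ i, (s i).indicator f (x i) := by
    intro x
    by_cases hx : x ∈ Set.univ.pi s
    · rw [Set.indicator_of_mem hx]
      refine Finset.prod_congr rfl fun i _ => ?_
      rw [Set.indicator_of_mem (hx i (Set.mem_univ i))]
    · rw [Set.indicator_of_notMem hx]
      simp only [Set.mem_univ_pi, not_forall] at hx
      obtain ⟨i, hi⟩ := hx
      exact (Finset.prod_eq_zero (Finset.mem_univ i) (Set.indicator_of_notMem hi _)).symm
  simp_rw [h1]
  have hm : ∀ i, Measurable ((s i).indicator f) := fun i => hf.indicator (hs i)
  rw [lintegral_prod_eq_prod_lintegral_of_indepFun Finset.univ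
    (fun i (x : Fin T → ℝ) => (s i).indicator f (x i))
    (iIndepFun_pi (X := fun i => (s i).indicator f) (fun i => (hm i).aemeasurable))
    (fun i => (hm i).comp (measurable_pi_apply i))]
  refine Finset.prod_congr rfl fun i _ => ?_
  rw [withDensity_apply _ (hs i), ← lintegral_indicator (hs i)]
  exact (measurePreserving_eval (fun _ : Fin T => μ) i).lintegral_comp (hm i)

theorem aux_gauss (σ : ℝ) : ∃ v : NNReal, (v : ℝ) = σ ^ 2 ∧
    ∀ m, gaussMeasure m σ = gaussianReal m v :=
  ⟨⟨σ ^ 2, sq_nonneg σ⟩, rfl, fun _ => rfl⟩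

theorem aux_one (σ : ℝ) (hσ : 0 < σ) : gaussMeasure 1 σ
    = (gaussMeasure 0 σ).withDensity
      (fun x => ENNReal.ofReal (Real.exp ((2 * x - 1) / (2 * σ ^ 2)))) := by
  obtain ⟨v, hvσ, hG⟩ := aux_gauss σ
  have hv : v ≠ 0 := by
    rintro rfl
    have : (0 : ℝ) < σ ^ 2 := by positivity
    simp [← hvσ] at this
  rw [hG, hG]
  rw [gaussianReal_of_var_ne_zero _ hv, gaussianReal_of_var_ne_zero _ hv,
    ← withDensity_mul _ (measurable_gaussianPDF _ _) (by fun_prop)]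
  congr 1
  ext x
  simp only [Pi.mul_apply, gaussianPDF]
  rw [← ENNReal.ofReal_mul (gaussianPDFReal_nonneg _ _ _)]
  congr 1
  simp only [gaussianPDFReal, hvσ]
  rw [mul_assoc _ (Real.exp _), ← Real.exp_add]
  congr 2
  field_simp
  ring

theorem aux_mix (σ : ℝ) (hσ : 0 < σ) (q : ℝ) (hq0 : 0 < q) (hq1 : q ≤ 1) : sgMixture σ q
    = (gaussMeasure 0 σ).withDensity
      (fun x => ENNReal.ofReal ((1 - q) + q * Real.exp ((2 * x - 1) / (2 * σ ^ 2)))) := by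
  unfold sgMixture
  rw [aux_one σ hσ, ← withDensity_smul _ (by fun_prop)]
  nth_rewrite 1 [← withDensity_one (μ := gaussMeasure 0 σ)]
  rw [← withDensity_smul _ measurable_one, ← withDensity_add_left (by fun_prop)]
  congr 1
  ext x
  simp only [Pi.add_apply, Pi.smul_apply, Pi.one_apply, smul_eq_mul, mul_one]
  rw [ENNReal.ofReal_add (by linarith) (by positivity), ENNReal.ofReal_mul hq0.le]

theorem aux_int (σ : ℝ) (hσ : 0 < σ) (q : ℝ) (α : ℕ) :
    ∫ x, ((1 - q) + q * Real.exp ((2 * x - 1) / (2 * σ ^ 2))) ^ α ∂(gaussMeasure 0 σ)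
     = ∑ k ∈ Finset.range (α + 1),
          (α.choose k : ℝ) * (1 - q) ^ (α - k) * q ^ k
            * Real.exp (((k : ℝ) ^ 2 - (k : ℝ)) / (2 * σ ^ 2)) := by
  have h1 : ∀ x : ℝ, ((1 - q) + q * Real.exp ((2 * x - 1) / (2 * σ ^ 2))) ^ α
      = ∑ k ∈ Finset.range (α + 1), ((α.choose k : ℝ) * (1 - q) ^ (α - k) * q ^ k
            * Real.exp (-k / (2 * σ ^ 2))) * Real.exp ((k / σ ^ 2) * x) := by
    intro x
    rw [add_comm, add_pow]
    refine Finset.sum_congr rfl fun k _ => ?_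
    rw [mul_assoc _ (Real.exp _), ← Real.exp_add, mul_pow, ← Real.exp_nat_mul]
    have : (k:ℝ) * ((2 * x - 1) / (2 * σ ^ 2)) = -k / (2 * σ ^ 2) + k / σ ^ 2 * x := by
      field_simp
      ring
    rw [this]
    ring
  simp_rw [h1]
  obtain ⟨v, hvσ, hG⟩ := aux_gauss σ
  rw [hG, integral_finsetSum _ (fun k _ => (integrable_exp_mul_gaussianReal _).const_mul _)]
  refine Finset.sum_congr rfl fun k _ => ?_
  rw [integral_const_mul]
  have := congrFun (mgf_fun_id_gaussianReal (μ := 0) (v := v)) (k / σ ^ 2)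
  unfold mgf at this
  rw [this, mul_assoc _ (Real.exp _), ← Real.exp_add]
  congr 2
  rw [hvσ]
  field_simp
  ring

/-- For every `σ > 0`, `q ∈ (0,1]`, natural number `α ≥ 2` and `T ≥ 1`, the `α`-th moment
of the likelihood ratio of the `T`-fold products satisfies
`∫ (d(μ_q^{⊗T})/d(μ₀^{⊗T}))^α d(μ₀^{⊗T}) = A_α(q,σ)^T`, and hence
`D_α(μ_q^{⊗T} ‖ μ₀^{⊗T}) = (T/(α-1)) log A_α(q,σ)`, where
`A_α(q,σ) = ∑_{k=0}^{α} C(α,k) (1-q)^{α-k} q^k exp ((k²-k)/(2σ²))`. -/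
theorem renyiDiv_pi_sgMixture (σ : ℝ) (hσ : 0 < σ)
    (q : ℝ) (hq0 : 0 < q) (hq1 : q ≤ 1) (α : ℕ) (hα : 2 ≤ α) (T : ℕ) (hT : 1 ≤ T) :
    (∫ x, ((Measure.pi fun _ : Fin T => sgMixture σ q).rnDeriv
          (Measure.pi fun _ : Fin T => gaussMeasure 0 σ) x).toReal ^ (α : ℝ)
        ∂(Measure.pi fun _ : Fin T => gaussMeasure 0 σ))
      = (∑ k ∈ Finset.range (α + 1),
          (α.choose k : ℝ) * (1 - q) ^ (α - k) * q ^ k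
            * Real.exp (((k : ℝ) ^ 2 - (k : ℝ)) / (2 * σ ^ 2))) ^ T ∧
    renyiDiv (α : ℝ) (Measure.pi fun _ : Fin T => sgMixture σ q)
        (Measure.pi fun _ : Fin T => gaussMeasure 0 σ)
      = ((T : ℝ) / ((α : ℝ) - 1)) * Real.log (∑ k ∈ Finset.range (α + 1),
          (α.choose k : ℝ) * (1 - q) ^ (α - k) * q ^ k
            * Real.exp (((k : ℝ) ^ 2 - (k : ℝ)) / (2 * σ ^ 2))) := by
  have hg0 : ∀ x : ℝ, 0 ≤ (1 - q) + q * Real.exp ((2 * x - 1) / (2 * σ ^ 2)) := by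
    intro x
    have : 0 ≤ 1 - q := by linarith
    positivity
  obtain ⟨v, hvσ, hG⟩ := aux_gauss σ
  have p0 : IsProbabilityMeasure (gaussMeasure 0 σ) := by rw [hG]; infer_instance
  have p1 : IsProbabilityMeasure (gaussMeasure 1 σ) := by rw [hG]; infer_instance
  have pq : IsProbabilityMeasure (sgMixture σ q) := by
    constructor
    simp only [sgMixture, Measure.add_apply, Measure.smul_apply, measure_univ, smul_eq_mul, mul_one]
    rw [← ENNReal.ofReal_add (by linarith) hq0.le]
    simp
  have hmix := aux_mix σ hσ q hq0 hq1
  have key : (∫ x, ((Measure.pi fun _ : Fin T => sgMixture σ q).rnDeriv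
          (Measure.pi fun _ : Fin T => gaussMeasure 0 σ) x).toReal ^ (α : ℝ)
        ∂(Measure.pi fun _ : Fin T => gaussMeasure 0 σ))
      = (∑ k ∈ Finset.range (α + 1),
          (α.choose k : ℝ) * (1 - q) ^ (α - k) * q ^ k
            * Real.exp (((k : ℝ) ^ 2 - (k : ℝ)) / (2 * σ ^ 2))) ^ T := by
    rw [hmix] at pq ⊢
    rw [aux_pi_withDensity _ _ (by fun_prop), ← aux_int σ hσ q α]
    have hI := integral_fintype_prod_eq_pow (ι := Fin T) (μ := gaussMeasure 0 σ)
      (fun x : ℝ => ((1 - q) + q * Real.exp ((2 * x - 1) / (2 * σ ^ 2))) ^ α)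
    rw [Fintype.card_fin] at hI
    rw [← hI]
    refine integral_congr_ae ?_
    filter_upwards [Measure.rnDeriv_withDensity (Measure.pi fun _ : Fin T => gaussMeasure 0 σ)
      (f := fun x => ∏ i, ENNReal.ofReal ((1 - q) + q * Real.exp ((2 * x i - 1) / (2 * σ ^ 2))))
      (by fun_prop)] with x hx
    rw [hx, Real.rpow_natCast, ENNReal.toReal_prod, ← Finset.prod_pow]
    refine Finset.prod_congr rfl fun i _ => ?_
    rw [ENNReal.toReal_ofReal (hg0 _)]
  refine ⟨key, ?_⟩
  unfold renyiDiv
  rw [key, Real.log_pow]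
  ring
end

section
/- (Theorem 2 of the paper, instantiated on the sampled Gaussian mechanism distributions.) For every σ > 0, every sampling rate q ∈ (0,1], every natural number α ≥ 2, and every natural number T ≥ 1, the total Rényi privacy loss over T iterations satisfies D_α(μ_q^{⊗T} ‖ μ0^{⊗T}) ≤ (T/(α−1)) · Σ_{k=0}^{α} C(α,k) (1 − q)^{α−k} q^k exp((k² − k)/(2σ²)). -/
open MeasureTheory ProbabilityTheory

theorem gaussMeasure_eq_aux (m σ : ℝ) :
    gaussMeasure m σ = gaussianReal m (Real.toNNReal (σ ^ 2)) := by
  have h : Real.toNNReal (σ ^ 2) = (⟨σ ^ 2, sq_nonneg σ⟩ : NNReal) :=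
    Real.toNNReal_of_nonneg (sq_nonneg σ)
  exact congrArg (gaussianReal m) h.symm

theorem pi_withDensity_aux {T : ℕ} (ν : Measure ℝ) [IsProbabilityMeasure ν] (f : ℝ → ℝ)
    (hfm : Measurable f) (hf0 : ∀ x, 0 ≤ f x) (hfi : Integrable f ν) :
    (Measure.pi fun _ : Fin T => ν.withDensity fun x => ENNReal.ofReal (f x))
      = (Measure.pi fun _ : Fin T => ν).withDensity
          fun x => ENNReal.ofReal (∏ i, f (x i)) := by
  have : IsFiniteMeasure (ν.withDensity fun x => ENNReal.ofReal (f x)) :=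
    isFiniteMeasure_withDensity_ofReal hfi.2
  apply Measure.pi_eq
  intro s hs
  rw [withDensity_apply _ (MeasurableSet.univ_pi hs), Measure.restrict_pi_pi]
  have hint : Integrable (fun x : Fin T → ℝ => ∏ i, f (x i))
      (Measure.pi fun i => ν.restrict (s i)) :=
    Integrable.fintype_prod (f := fun _ => f) (fun i => hfi.restrict)
  rw [← ofReal_integral_eq_lintegral_ofReal hint
    (Filter.Eventually.of_forall fun x => Finset.prod_nonneg fun i _ => hf0 _)]
  rw [integral_fintype_prod_eq_prod (fun _ => f),
    ENNReal.ofReal_prod_of_nonneg (fun i _ => integral_nonneg hf0)]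
  refine Finset.prod_congr rfl fun i _ => ?_
  rw [withDensity_apply _ (hs i), ofReal_integral_eq_lintegral_ofReal hfi.restrict
    (Filter.Eventually.of_forall hf0)]

theorem exp_pow_aux (σ : ℝ) (k : ℕ) (x : ℝ) :
    Real.exp ((2 * x - 1) / (2 * σ ^ 2)) ^ k
      = Real.exp (-(k / (2 * σ ^ 2))) * Real.exp ((k / σ ^ 2) * x) := by
  rw [← Real.exp_nat_mul, ← Real.exp_add]
  congr 1
  by_cases h : σ = 0
  · simp [h]
  · field_simp
    ring

theorem integrable_pow_aux (σ : ℝ) (k : ℕ) :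
    Integrable (fun x => Real.exp ((2 * x - 1) / (2 * σ ^ 2)) ^ k) (gaussMeasure 0 σ) := by
  simp_rw [exp_pow_aux]
  exact (integrable_exp_mul_gaussianReal _).const_mul _

theorem integral_pow_aux (σ : ℝ) (hσ : 0 < σ) (k : ℕ) :
    ∫ x, Real.exp ((2 * x - 1) / (2 * σ ^ 2)) ^ k ∂(gaussMeasure 0 σ)
      = Real.exp (((k : ℝ) ^ 2 - (k : ℝ)) / (2 * σ ^ 2)) := by
  simp_rw [exp_pow_aux]
  rw [integral_const_mul]
  have h := congrFun (mgf_fun_id_gaussianReal (μ := 0) (v := Real.toNNReal (σ ^ 2))) (k / σ ^ 2)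
  simp only [mgf] at h
  rw [gaussMeasure_eq_aux, h, ← Real.exp_add]
  congr 1
  rw [Real.coe_toNNReal _ (sq_nonneg σ)]
  field_simp
  ring

theorem gauss_one_aux (σ : ℝ) (hσ : 0 < σ) :
    gaussMeasure 1 σ = (gaussMeasure 0 σ).withDensity
      fun x => ENNReal.ofReal (Real.exp ((2 * x - 1) / (2 * σ ^ 2))) := by
  have hv : Real.toNNReal (σ ^ 2) ≠ 0 := by
    have : 0 < Real.toNNReal (σ ^ 2) := Real.toNNReal_pos.2 (by positivity)
    exact this.ne'
  rw [gaussMeasure_eq_aux, gaussMeasure_eq_aux, gaussianReal_of_var_ne_zero _ hv,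
    gaussianReal_of_var_ne_zero _ hv, ← withDensity_mul _ (measurable_gaussianPDF _ _)
      (by fun_prop)]
  congr 1
  ext x
  simp only [Pi.mul_apply, gaussianPDF]
  rw [← ENNReal.ofReal_mul (gaussianPDFReal_nonneg _ _ _)]
  congr 1
  simp only [gaussianPDFReal, Real.coe_toNNReal _ (sq_nonneg σ)]
  rw [mul_assoc _ (Real.exp _) (Real.exp _), ← Real.exp_add]
  congr 2
  field_simp
  ring

theorem sgMixture_aux (σ : ℝ) (hσ : 0 < σ) (q : ℝ) (hq0 : 0 < q) (hq1 : q ≤ 1) :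
    sgMixture σ q = (gaussMeasure 0 σ).withDensity
      fun x => ENNReal.ofReal (q * Real.exp ((2 * x - 1) / (2 * σ ^ 2)) + (1 - q)) := by
  have h : (fun x : ℝ => ENNReal.ofReal (q * Real.exp ((2 * x - 1) / (2 * σ ^ 2)) + (1 - q)))
      = (fun _ => ENNReal.ofReal (1 - q)) + ENNReal.ofReal q •
        fun x => ENNReal.ofReal (Real.exp ((2 * x - 1) / (2 * σ ^ 2))) := by
    ext x
    simp only [Pi.add_apply, Pi.smul_apply, smul_eq_mul]
    rw [ENNReal.ofReal_add (by positivity) (by linarith), ENNReal.ofReal_mul hq0.le, add_comm]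
  rw [h, withDensity_add_left measurable_const, withDensity_const,
    withDensity_smul _ (by fun_prop), ← gauss_one_aux σ hσ, sgMixture]

/-- Theorem 2 of the paper, instantiated on the sampled Gaussian mechanism distributions:
for every `σ > 0`, `q ∈ (0,1]`, natural number `α ≥ 2` and `T ≥ 1`, the total Rényi
privacy loss over `T` iterations satisfies
`D_α(μ_q^{⊗T} ‖ μ₀^{⊗T}) ≤ (T/(α-1)) ∑_{k=0}^{α} C(α,k) (1-q)^{α-k} q^k exp ((k²-k)/(2σ²))`. -/
theorem renyiDiv_pi_sgMixture_le (σ : ℝ) (hσ : 0 < σ)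
    (q : ℝ) (hq0 : 0 < q) (hq1 : q ≤ 1) (α : ℕ) (hα : 2 ≤ α) (T : ℕ) (hT : 1 ≤ T) :
    renyiDiv (α : ℝ) (Measure.pi fun _ : Fin T => sgMixture σ q)
        (Measure.pi fun _ : Fin T => gaussMeasure 0 σ)
      ≤ ((T : ℝ) / ((α : ℝ) - 1)) * ∑ k ∈ Finset.range (α + 1),
          (α.choose k : ℝ) * (1 - q) ^ (α - k) * q ^ k
            * Real.exp (((k : ℝ) ^ 2 - (k : ℝ)) / (2 * σ ^ 2)) := by
  have : IsProbabilityMeasure (gaussMeasure 0 σ) := by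
    rw [gaussMeasure_eq_aux]; infer_instance
  have hsum : ∀ x : ℝ, (q * Real.exp ((2 * x - 1) / (2 * σ ^ 2)) + (1 - q)) ^ α
      = ∑ k ∈ Finset.range (α + 1), ((α.choose k : ℝ) * (1 - q) ^ (α - k) * q ^ k)
          * Real.exp ((2 * x - 1) / (2 * σ ^ 2)) ^ k := by
    intro x
    rw [add_pow]
    refine Finset.sum_congr rfl fun k _ => ?_
    rw [mul_pow]
    ring
  have hf0 : ∀ x : ℝ, 0 ≤ q * Real.exp ((2 * x - 1) / (2 * σ ^ 2)) + (1 - q) := by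
    intro x
    have : 0 ≤ q * Real.exp ((2 * x - 1) / (2 * σ ^ 2)) := by positivity
    linarith
  have hfi : Integrable (fun x : ℝ => q * Real.exp ((2 * x - 1) / (2 * σ ^ 2)) + (1 - q))
      (gaussMeasure 0 σ) := by
    have h1 := integrable_pow_aux σ 1
    simp only [pow_one] at h1
    exact (h1.const_mul q).add (integrable_const _)
  have hI : ∫ x, (q * Real.exp ((2 * x - 1) / (2 * σ ^ 2)) + (1 - q)) ^ α ∂(gaussMeasure 0 σ)
      = ∑ k ∈ Finset.range (α + 1),
          (α.choose k : ℝ) * (1 - q) ^ (α - k) * q ^ k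
            * Real.exp (((k : ℝ) ^ 2 - (k : ℝ)) / (2 * σ ^ 2)) := by
    simp_rw [hsum]
    rw [integral_finsetSum _ fun k _ => (integrable_pow_aux σ k).const_mul _]
    refine Finset.sum_congr rfl fun k _ => ?_
    rw [integral_const_mul, integral_pow_aux σ hσ]
  rw [← hI]
  have hnn : 0 ≤ ∫ x, (q * Real.exp ((2 * x - 1) / (2 * σ ^ 2)) + (1 - q)) ^ α
      ∂(gaussMeasure 0 σ) := integral_nonneg fun x => pow_nonneg (hf0 x) _
  have hfm : Measurable (fun x : ℝ => q * Real.exp ((2 * x - 1) / (2 * σ ^ 2)) + (1 - q)) := by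
    fun_prop
  have hD : ∫ x, ((Measure.pi fun _ : Fin T => sgMixture σ q).rnDeriv
      (Measure.pi fun _ : Fin T => gaussMeasure 0 σ) x).toReal ^ (α : ℝ)
        ∂(Measure.pi fun _ : Fin T => gaussMeasure 0 σ)
      = (∫ x, (q * Real.exp ((2 * x - 1) / (2 * σ ^ 2)) + (1 - q)) ^ α
          ∂(gaussMeasure 0 σ)) ^ T := by
    rw [sgMixture_aux σ hσ q hq0 hq1, pi_withDensity_aux _ _ hfm hf0 hfi]
    have h2 := integral_fintype_prod_eq_pow (ι := Fin T) (μ := gaussMeasure 0 σ)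
      (fun x : ℝ => (q * Real.exp ((2 * x - 1) / (2 * σ ^ 2)) + (1 - q)) ^ α)
    rw [Fintype.card_fin] at h2
    rw [← h2]
    apply integral_congr_ae
    have hm : Measurable fun x : Fin T → ℝ => ENNReal.ofReal
        (∏ i, (q * Real.exp ((2 * x i - 1) / (2 * σ ^ 2)) + (1 - q))) := by fun_prop
    filter_upwards [Measure.rnDeriv_withDensity
      (Measure.pi fun _ : Fin T => gaussMeasure 0 σ) hm] with x hx
    rw [hx, ENNReal.toReal_ofReal (Finset.prod_nonneg fun i _ => hf0 _), Real.rpow_natCast,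
      Finset.prod_pow]
  have hα' : (0 : ℝ) < (α : ℝ) - 1 := by
    have : (2 : ℝ) ≤ α := by exact_mod_cast hα
    linarith
  rw [renyiDiv, hD, Real.log_pow, ← mul_assoc]
  have : 1 / ((α : ℝ) - 1) * T = T / ((α : ℝ) - 1) := by ring
  rw [this]
  exact mul_le_mul_of_nonneg_left (Real.log_le_self hnn) (by positivity)
end
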